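/- Fix real numbers B > 0 and C, and fix a closed interval [X,Y] with X > −C/B. Then for every ε > 0, as Δ → ∞, the number of pairs (m,n) with n ≥ 1, gcd(m,n)=1, X ≤ m/n ≤ Y, and 0 < B·m·n + C·n^2 ≤ Δ equals (3Δ/π^2)·(1/B)·( log(B·Y + C) − log(B·X + C) ) + O(Δ^{1/2+ε}). -/

import Mathlib

open Real

theorem abs_harmonic_floor_sub_log_le {s : ℝ} (hs : 1 ≤ s) :
    |(harmonic ⌊s⌋₊ : ℝ) - eulerMascheroniConstant - log s| ≤ 2 / s := by
  set N := ⌊s⌋₊ with hN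
  have hN1 : 1 ≤ N := Nat.one_le_floor_iff s |>.2 hs
  have hN1' : (1 : ℝ) ≤ N := by exact_mod_cast hN1
  have hle : (N : ℝ) ≤ s := Nat.floor_le (by linarith)
  have hlt : s < N + 1 := Nat.lt_floor_add_one s
  have h1 := eulerMascheroniSeq_lt_eulerMascheroniConstant N
  have h2 := eulerMascheroniConstant_lt_eulerMascheroniSeq' N
  rw [eulerMascheroniSeq] at h1
  rw [eulerMascheroniSeq', if_neg (by omega)] at h2
  have h3 : log N ≤ log s := log_le_log (by linarith) hle
  have h4 : log s ≤ log (N + 1) := log_le_log (by linarith) hlt.le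
  have h5 : log (N + 1) - log N ≤ 2 / s := by
    rw [← log_div (by linarith) (by linarith)]
    have h6 := log_le_sub_one_of_pos (show (0 : ℝ) < (N + 1) / N by positivity)
    have h7 : ((N : ℝ) + 1) / N - 1 = 1 / N := by field_simp; ring
    have h8 : (1 : ℝ) / N ≤ 2 / s := by
      rw [div_le_div_iff₀ (by linarith) (by linarith)]; linarith
    linarith
  rw [abs_le]
  constructor <;> linarith

theorem abs_sum_sq_div_sub_self_le {s : ℝ} (hs : 0 < s) :
    |∑ n ∈ Finset.Icc 1 ⌊s⌋₊, (s ^ 2 / n - n) -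
      (s ^ 2 * log s + (eulerMascheroniConstant - 1 / 2) * s ^ 2)| ≤ 3 * s := by
  have hsum : ∑ n ∈ Finset.Icc 1 ⌊s⌋₊, (s ^ 2 / n - n) =
      s ^ 2 * (harmonic ⌊s⌋₊ : ℝ) - (⌊s⌋₊ : ℝ) * (⌊s⌋₊ + 1) / 2 := by
    induction ⌊s⌋₊ with
    | zero => simp
    | succ k ih =>
      rw [Finset.sum_Icc_succ_top (by omega), ih, harmonic_succ]
      push_cast
      field_simp
      ring
  rw [hsum]
  have hg1 := one_half_lt_eulerMascheroniConstant
  have hg2 := eulerMascheroniConstant_lt_two_thirds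
  rcases lt_or_ge s 1 with h1 | h1
  · rw [Nat.floor_eq_zero.2 h1]
    have hl := log_le_sub_one_of_pos (inv_pos.2 hs)
    rw [log_inv] at hl
    have hl2 : log s ≤ 0 := log_nonpos hs.le h1.le
    have hl3 : s * -log s ≤ 1 := by
      calc s * -log s ≤ s * s⁻¹ := by gcongr; linarith
        _ = 1 := by field_simp
    simp only [harmonic_zero, Rat.cast_zero, Nat.cast_zero]
    rw [abs_le]
    constructor <;> nlinarith [mul_pos hs hs, mul_nonneg hs.le (neg_nonneg.2 hl2)]
  · have hh := abs_harmonic_floor_sub_log_le h1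
    have hle : (⌊s⌋₊ : ℝ) ≤ s := Nat.floor_le (by linarith)
    have hlt : s < ⌊s⌋₊ + 1 := Nat.lt_floor_add_one s
    set N := (⌊s⌋₊ : ℝ)
    set H := (harmonic ⌊s⌋₊ : ℝ)
    have hh2 : |s ^ 2 * (H - eulerMascheroniConstant - log s)| ≤ 2 * s := by
      rw [abs_mul, abs_of_nonneg (sq_nonneg s)]
      calc _ ≤ s ^ 2 * (2 / s) := by gcongr
        _ = 2 * s := by field_simp
    rw [abs_le] at hh2 ⊢
    constructor <;> nlinarith

theorem abs_sum_max_zero_div_sub_mul_le {c t : ℝ} (hc : 0 < c) (ht : 0 < t) {M : ℕ}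
    (hM : ⌊√(t / c)⌋₊ ≤ M) :
    |∑ n ∈ Finset.Icc 1 M, max 0 (t / n - c * n) -
      (t * (log t - log c) / 2 + (eulerMascheroniConstant - 1 / 2) * t)| ≤
      3 * √c * √t := by
  set s := √(t / c) with hs
  have hs0 : 0 < s := by positivity
  have hs2 : c * s ^ 2 = t := by rw [hs, sq_sqrt (by positivity)]; field_simp
  have hcs : c * s = √c * √t := by
    rw [hs, sqrt_div ht.le, mul_div_assoc', div_eq_iff (by positivity)]
    rw [mul_right_comm, mul_self_sqrt hc.le]
  have hlog : log s = (log t - log c) / 2 := by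
    rw [hs, log_sqrt (by positivity), log_div ht.ne' hc.ne']
  have hsum : ∑ n ∈ Finset.Icc 1 M, max 0 (t / n - c * n) =
      c * ∑ n ∈ Finset.Icc 1 ⌊s⌋₊, (s ^ 2 / n - n) := by
    rw [Finset.mul_sum]
    symm
    apply Finset.sum_subset_zero_on_sdiff (Finset.Icc_subset_Icc_right hM)
    · intro n hn
      simp only [Finset.mem_sdiff, Finset.mem_Icc, not_and, not_le] at hn
      have hn0 : (0 : ℝ) < n := by exact_mod_cast hn.1.1
      have hsn : s < n := (Nat.floor_lt hs0.le).1 (hn.2 hn.1.1)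
      apply max_eq_left
      rw [sub_nonpos, div_le_iff₀ hn0, ← hs2]
      nlinarith [mul_lt_mul'' hsn hsn hs0.le hs0.le]
    · intro n hn
      rw [Finset.mem_Icc] at hn
      have hn0 : (0 : ℝ) < n := by exact_mod_cast hn.1
      have hsn : (n : ℝ) ≤ s := (Nat.le_floor_iff hs0.le).1 hn.2
      rw [max_eq_right]
      · rw [← hs2]; ring
      · rw [sub_nonneg, le_div_iff₀ hn0, ← hs2]
        nlinarith [mul_le_mul hsn hsn hn0.le hs0.le]
  have key := abs_sum_sq_div_sub_self_le hs0
  rw [hsum]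
  calc _ = |c * (∑ n ∈ Finset.Icc 1 ⌊s⌋₊, (s ^ 2 / n - n) -
      (s ^ 2 * log s + (eulerMascheroniConstant - 1 / 2) * s ^ 2))| := by
        rw [mul_sub, hlog, ← hs2]; congr 1; ring
    _ ≤ c * (3 * s) := by rw [abs_mul, abs_of_pos hc]; gcongr
    _ = 3 * √c * √t := by rw [mul_left_comm, hcs]; ring

/-- The integer points `(m, n)` with `n ≥ 1` in the sector `X n ≤ m ≤ Y n` with
`B m n + C n² ≤ t`. -/
noncomputable def sectorPoints (B C X Y t : ℝ) : Finset (ℤ × ℤ) :=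
  ((Finset.Icc 1 ⌊√(t / (B * X + C))⌋₊).sigma fun n : ℕ =>
    Finset.Icc ⌈X * n⌉ ⌊min (Y * n) ((t / n - C * n) / B)⌋).image fun q => (q.2, (q.1 : ℤ))

theorem mem_sectorPoints {B C X Y t : ℝ} (hB : 0 < B) (ha : 0 < B * X + C) (p : ℤ × ℤ) :
    p ∈ sectorPoints B C X Y t ↔ 1 ≤ p.2 ∧ X * p.2 ≤ p.1 ∧ p.1 ≤ Y * p.2 ∧
      B * p.1 * p.2 + C * (p.2 : ℝ) ^ 2 ≤ t := by
  obtain ⟨m, n⟩ := p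
  have key : ∀ k : ℕ, 1 ≤ k → ((m : ℝ) ≤ (t / k - C * k) / B ↔
      B * m * k + C * (k : ℝ) ^ 2 ≤ t) := by
    intro k hk
    have hk0 : (0 : ℝ) < k := by exact_mod_cast hk
    rw [le_div_iff₀ hB, le_sub_iff_add_le, le_div_iff₀ hk0]
    ring_nf
  simp only [sectorPoints, Finset.mem_image, Finset.mem_sigma, Finset.mem_Icc, Prod.mk.injEq,
    Int.ceil_le, Int.le_floor, le_min_iff]
  constructor
  · rintro ⟨⟨k, m'⟩, ⟨⟨h1, -⟩, h3, h4, h5⟩, rfl, rfl⟩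
    have h6 := (key k h1).1 h5
    exact ⟨by exact_mod_cast h1, by simpa using h3, by simpa using h4, by simpa using h6⟩
  · rintro ⟨h1, h2, h3, h4⟩
    lift n to ℕ using by omega
    have h1' : 1 ≤ n := by exact_mod_cast h1
    have hn0 : (0 : ℝ) < n := by exact_mod_cast h1'
    simp only [Int.cast_natCast] at h2 h3 h4
    refine ⟨⟨n, m⟩, ⟨⟨h1', ?_⟩, h2, h3, (key n h1').2 h4⟩, rfl, rfl⟩
    apply Nat.le_floor
    apply Real.le_sqrt_of_sq_le
    rw [le_div_iff₀ ha]
    have : 0 ≤ B * n * (m - X * n) := by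
      have : 0 ≤ (m : ℝ) - X * n := by linarith
      positivity
    nlinarith

theorem card_sectorPoints (B C X Y t : ℝ) :
    (sectorPoints B C X Y t).card = ∑ n ∈ Finset.Icc 1 ⌊√(t / (B * X + C))⌋₊,
      (Finset.Icc ⌈X * n⌉ ⌊min (Y * n) ((t / n - C * n) / B)⌋).card := by
  rw [sectorPoints, Finset.card_image_of_injective, Finset.card_sigma]
  rintro ⟨k, m⟩ ⟨k', m'⟩ h
  simp only [Prod.mk.injEq, Nat.cast_inj] at h
  obtain ⟨rfl, rfl⟩ := h
  rfl

theorem abs_card_Icc_ceil_floor_sub_le {u v : ℝ} (h : u ≤ v) :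
    |((Finset.Icc ⌈u⌉ ⌊v⌋).card : ℝ) - (v - u)| ≤ 1 := by
  have h1 : ⌈u⌉ ≤ ⌊v⌋ + 1 := Int.ceil_le.2 (by push_cast; linarith [Int.lt_floor_add_one v])
  have h2 : ((Finset.Icc ⌈u⌉ ⌊v⌋).card : ℝ) = ⌊v⌋ + 1 - ⌈u⌉ := by
    rw [Int.card_Icc]
    have : (((⌊v⌋ + 1 - ⌈u⌉).toNat : ℤ) : ℝ) = ((⌊v⌋ + 1 - ⌈u⌉ : ℤ) : ℝ) := by
      rw [Int.toNat_of_nonneg (by omega)]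
    push_cast at this
    exact this
  rw [h2, abs_le]
  constructor <;>
    linarith [Int.lt_floor_add_one v, Int.floor_le v, Int.le_ceil u, Int.ceil_lt_add_one u]

theorem exists_abs_card_sectorPoints_sub_le {B C X Y : ℝ} (hB : 0 < B) (ha : 0 < B * X + C)
    (hXY : X ≤ Y) :
    ∃ K : ℝ, 0 < K ∧ ∀ t : ℝ, 0 < t → |((sectorPoints B C X Y t).card : ℝ) -
      (log (B * Y + C) - log (B * X + C)) / (2 * B) * t| ≤ K * √t := by
  have hab : B * X + C ≤ B * Y + C := by gcongr
  have hb : 0 < B * Y + C := ha.trans_le hab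
  set a := B * X + C with ha_def
  set b := B * Y + C with hb_def
  refine ⟨1 / √a + (3 * √a + 3 * √b) / B, by positivity, fun t ht => ?_⟩
  set Q := ⌊√(t / a)⌋₊ with hQ
  have hQa : (Q : ℝ) ≤ 1 / √a * √t := by
    have := Nat.floor_le (sqrt_nonneg (t / a))
    rw [sqrt_div ht.le] at this
    calc (Q : ℝ) ≤ √t / √a := by rw [hQ, sqrt_div ht.le]; exact this
      _ = _ := by ring
  have hPQ : ⌊√(t / b)⌋₊ ≤ Q := by
    rw [hQ]; gcongr
  have hterm : ∀ n ∈ Finset.Icc 1 Q,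
      |((Finset.Icc ⌈X * n⌉ ⌊min (Y * n) ((t / n - C * n) / B)⌋).card : ℝ) -
        (max 0 (t / n - a * n) - max 0 (t / n - b * n)) / B| ≤ 1 := by
    intro n hn
    rw [Finset.mem_Icc] at hn
    have hn0 : (0 : ℝ) < n := by exact_mod_cast hn.1
    have hna : a * n ≤ t / n := by
      have h1 : (n : ℝ) ≤ √(t / a) := (Nat.le_floor_iff (sqrt_nonneg _)).1 hn.2
      have h2 := (Real.le_sqrt hn0.le (by positivity)).1 h1
      rw [le_div_iff₀ ha] at h2
      rw [le_div_iff₀ hn0]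
      linarith
    have hle : X * n ≤ min (Y * n) ((t / n - C * n) / B) := by
      apply le_min (by gcongr)
      rw [le_div_iff₀ hB]
      rw [ha_def] at hna
      linarith
    have heq : min (Y * n) ((t / n - C * n) / B) - X * n =
        (max 0 (t / n - a * n) - max 0 (t / n - b * n)) / B := by
      rw [max_eq_right (show 0 ≤ t / n - a * n by linarith)]
      rcases le_total 0 (t / n - b * n) with h | h
      · rw [max_eq_right h, min_eq_left]
        · rw [ha_def, hb_def]; field_simp; ring
        · rw [le_div_iff₀ hB]
          rw [hb_def] at h
          linarith
      · rw [max_eq_left h, min_eq_right]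
        · rw [ha_def]; field_simp; ring
        · rw [div_le_iff₀ hB]
          rw [hb_def] at h
          linarith
    rw [← heq]
    exact abs_card_Icc_ceil_floor_sub_le hle
  have hA := abs_sum_max_zero_div_sub_mul_le ha ht le_rfl
  have hBb := abs_sum_max_zero_div_sub_mul_le hb ht hPQ
  rw [← hQ] at hA
  have hsum : |((sectorPoints B C X Y t).card : ℝ) -
      (∑ n ∈ Finset.Icc 1 Q, max 0 (t / n - a * n) -
        ∑ n ∈ Finset.Icc 1 Q, max 0 (t / n - b * n)) / B| ≤ Q := by
    rw [card_sectorPoints, ← Finset.sum_sub_distrib, Finset.sum_div, Nat.cast_sum,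
      ← Finset.sum_sub_distrib]
    refine (Finset.abs_sum_le_sum_abs _ _).trans ((Finset.sum_le_sum hterm).trans ?_)
    simp
  set SA := ∑ n ∈ Finset.Icc 1 Q, max 0 (t / n - a * n)
  set SB := ∑ n ∈ Finset.Icc 1 Q, max 0 (t / n - b * n)
  have hdiff : |(SA - SB) / B - (log b - log a) / (2 * B) * t| ≤
      (3 * √a * √t + 3 * √b * √t) / B := by
    have : (SA - SB) / B - (log b - log a) / (2 * B) * t =
      ((SA - (t * (log t - log a) / 2 + (eulerMascheroniConstant - 1 / 2) * t)) -
        (SB - (t * (log t - log b) / 2 + (eulerMascheroniConstant - 1 / 2) * t))) / B := by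
      field_simp; ring
    rw [this, abs_div, abs_of_pos hB]
    gcongr
    exact (abs_sub _ _).trans (add_le_add hA hBb)
  calc _ ≤ (Q : ℝ) + (3 * √a * √t + 3 * √b * √t) / B :=
        (abs_sub_le _ _ _).trans (add_le_add hsum hdiff)
    _ ≤ 1 / √a * √t + (3 * √a * √t + 3 * √b * √t) / B := by gcongr
    _ = _ := by ring

theorem card_filter_dvd_sectorPoints {B C X Y t : ℝ} (hB : 0 < B) (ha : 0 < B * X + C) {d : ℕ}
    (hd : 0 < d) :
    ((sectorPoints B C X Y t).filter fun p => d ∣ Int.gcd p.1 p.2).card =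
      (sectorPoints B C X Y (t / (d : ℝ) ^ 2)).card := by
  have hd' : (0 : ℝ) < d := by exact_mod_cast hd
  have hdz : (0 : ℤ) < d := by exact_mod_cast hd
  have hmem (m n : ℤ) : ((d : ℤ) * m, (d : ℤ) * n) ∈ sectorPoints B C X Y t ↔
      (m, n) ∈ sectorPoints B C X Y (t / (d : ℝ) ^ 2) := by
    rw [mem_sectorPoints hB ha, mem_sectorPoints hB ha, le_div_iff₀ (by positivity)]
    push_cast
    refine and_congr ?_ (and_congr ?_ (and_congr ?_ ?_))
    · constructor <;> intro h
      · exact pos_of_mul_pos_right (show 0 < (d : ℤ) * n by omega) hdz.le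
      · exact mul_pos hdz h
    · rw [mul_left_comm, mul_le_mul_iff_right₀ hd']
    · rw [mul_left_comm, mul_le_mul_iff_right₀ hd']
    · ring_nf
  symm
  refine Finset.card_bij (fun p _ => ((d : ℤ) * p.1, (d : ℤ) * p.2)) ?_ ?_ ?_
  · rintro ⟨m, n⟩ h
    rw [Finset.mem_filter]
    exact ⟨(hmem m n).2 h, Int.dvd_gcd (dvd_mul_right _ _) (dvd_mul_right _ _)⟩
  · rintro ⟨m, n⟩ _ ⟨m', n'⟩ _ h
    simp only [Prod.mk.injEq, mul_eq_mul_left_iff, hdz.ne', or_false] at h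
    rw [h.1, h.2]
  · rintro ⟨m, n⟩ h
    rw [Finset.mem_filter] at h
    have hz : (d : ℤ) ∣ (Int.gcd m n : ℤ) := by exact_mod_cast h.2
    obtain ⟨m', rfl⟩ := hz.trans (Int.gcd_dvd_left ..)
    obtain ⟨n', rfl⟩ := hz.trans (Int.gcd_dvd_right ..)
    exact ⟨(m', n'), (hmem m' n').1 h.1, rfl⟩

open ArithmeticFunction in
theorem sum_ite_dvd_moebius {g D : ℕ} (hg : 0 < g) (hgD : g ≤ D) :
    ∑ d ∈ Finset.Icc 1 D, (if d ∣ g then (moebius d : ℝ) else 0) = if g = 1 then 1 else 0 := by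
  have h := congrArg (fun f : ArithmeticFunction ℤ => f g) coe_zeta_mul_moebius
  simp only [coe_zeta_mul_apply, one_apply] at h
  rw [← Finset.sum_filter]
  have hfil : (Finset.Icc 1 D).filter (· ∣ g) = g.divisors := by
    ext d
    simp only [Finset.mem_filter, Finset.mem_Icc, Nat.mem_divisors]
    constructor
    · exact fun h => ⟨h.2, hg.ne'⟩
    · exact fun h => ⟨⟨Nat.pos_of_dvd_of_pos h.1 hg, (Nat.le_of_dvd hg h.1).trans hgD⟩, h.1⟩
  rw [hfil]
  exact_mod_cast h

theorem card_filter_gcd_eq_one_sectorPoints {B C X Y t : ℝ} (hB : 0 < B)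
    (ha : 0 < B * X + C) :
    (((sectorPoints B C X Y t).filter fun p => Int.gcd p.1 p.2 = 1).card : ℝ) =
      ∑ d ∈ Finset.Icc 1 ⌊√(t / (B * X + C))⌋₊,
        (ArithmeticFunction.moebius d : ℝ) * (sectorPoints B C X Y (t / (d : ℝ) ^ 2)).card := by
  have hgcd : ∀ p ∈ sectorPoints B C X Y t, 0 < Int.gcd p.1 p.2 ∧
      Int.gcd p.1 p.2 ≤ ⌊√(t / (B * X + C))⌋₊ := by
    intro p hp
    obtain ⟨⟨k, m⟩, hq, rfl⟩ := Finset.mem_image.1 hp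
    rw [Finset.mem_sigma, Finset.mem_Icc] at hq
    have hk : 0 < k := hq.1.1
    refine ⟨Int.gcd_pos_of_ne_zero_right _ (by simpa using hk.ne'), le_trans ?_ hq.1.2⟩
    have := Int.gcd_dvd_right m (k : ℤ)
    exact Nat.le_of_dvd hk (by exact_mod_cast this)
  rw [Finset.card_filter, Nat.cast_sum]
  calc _ = ∑ p ∈ sectorPoints B C X Y t, ∑ d ∈ Finset.Icc 1 ⌊√(t / (B * X + C))⌋₊,
        (if d ∣ Int.gcd p.1 p.2 then (ArithmeticFunction.moebius d : ℝ) else 0) := by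
        refine Finset.sum_congr rfl fun p hp => ?_
        rw [sum_ite_dvd_moebius (hgcd p hp).1 (hgcd p hp).2]
        push_cast
        rfl
    _ = _ := by
        rw [Finset.sum_comm]
        refine Finset.sum_congr rfl fun d hd => ?_
        rw [← card_filter_dvd_sectorPoints hB ha (Finset.mem_Icc.1 hd).1, ← Finset.sum_filter,
          Finset.sum_const, nsmul_eq_mul, mul_comm]

open ArithmeticFunction in
theorem hasSum_moebius_div_sq :
    HasSum (fun n : ℕ => (ArithmeticFunction.moebius n : ℝ) / (n : ℝ) ^ 2) (6 / π ^ 2) := by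
  have h2 : 1 < (2 : ℂ).re := by norm_num
  have hval : LSeries (fun n => ((ArithmeticFunction.moebius n : ℤ) : ℂ)) 2 =
      ((6 / π ^ 2 : ℝ) : ℂ) := by
    have h := LSeries_one_mul_Lseries_moebius h2
    rw [LSeries_one_eq_riemannZeta h2, riemannZeta_two] at h
    have hpi : (π : ℂ) ≠ 0 := by exact_mod_cast pi_ne_zero
    push_cast
    rw [eq_div_iff (pow_ne_zero 2 hpi)]
    linear_combination 6 * h
  have h := (LSeriesSummable_moebius_iff.2 h2).LSeriesHasSum
  rw [hval, LSeriesHasSum] at h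
  rw [← Complex.hasSum_ofReal]
  refine h.congr_fun fun n => ?_
  rw [LSeries.term_of_ne_zero' two_ne_zero]
  norm_cast

theorem abs_sum_moebius_div_sq_sub_le (D : ℕ) :
    |∑ d ∈ Finset.Icc 1 D, (ArithmeticFunction.moebius d : ℝ) / (d : ℝ) ^ 2 - 6 / π ^ 2| ≤
      2 / ((D : ℝ) + 1) := by
  have hlim := (tendsto_const_nhds (x := ∑ d ∈ Finset.Icc 1 D,
    (ArithmeticFunction.moebius d : ℝ) / (d : ℝ) ^ 2)).sub hasSum_moebius_div_sq.tendsto_sum_nat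
  refine le_of_tendsto hlim.abs (Filter.eventually_atTop.2 ⟨D + 1, fun n hn => ?_⟩)
  have hsplit : ∑ d ∈ Finset.range n, (ArithmeticFunction.moebius d : ℝ) / (d : ℝ) ^ 2 =
      ∑ d ∈ Finset.Icc 1 D, (ArithmeticFunction.moebius d : ℝ) / (d : ℝ) ^ 2 +
        ∑ d ∈ Finset.Ioo D n, (ArithmeticFunction.moebius d : ℝ) / (d : ℝ) ^ 2 := by
    rw [← Finset.sum_union]
    · symm
      apply Finset.sum_subset
      · intro d
        simp only [Finset.mem_union, Finset.mem_Icc, Finset.mem_Ioo, Finset.mem_range]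
        omega
      · intro d hd hd'
        simp only [Finset.mem_union, Finset.mem_Icc, Finset.mem_Ioo, Finset.mem_range] at hd hd'
        obtain rfl : d = 0 := by omega
        simp
    · rw [Finset.disjoint_left]
      intro d
      simp only [Finset.mem_Icc, Finset.mem_Ioo]
      omega
  rw [hsplit, sub_add_cancel_left, abs_neg]
  refine (Finset.abs_sum_le_sum_abs _ _).trans (le_trans (Finset.sum_le_sum fun d _ => ?_)
    (sum_Ioo_inv_sq_le (α := ℝ) D n))
  rw [abs_div, abs_of_nonneg (sq_nonneg (d : ℝ)), ← one_div]
  gcongr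
  exact_mod_cast ArithmeticFunction.abs_moebius_le_one

/-- For `B > 0` and `[X,Y] ⊆ (-C/B, ∞)`, the number of coprime pairs `(m,n)`, `n ≥ 1`,
with `X ≤ m/n ≤ Y` and `0 < Bmn + Cn² ≤ Δ` is
`(3Δ/π²)(1/B)(log(BY+C) - log(BX+C)) + O(Δ^{1/2+ε})`. -/
theorem equid_count_A_eq_zero (B C X Y : ℝ) (hB : 0 < B) (hX : -C / B < X) (hXY : X ≤ Y)
    (ε : ℝ) (hε : 0 < ε) :
    ∃ c : ℝ, 0 < c ∧ ∃ Δ₀ : ℝ, ∀ Δ : ℝ, Δ₀ ≤ Δ →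
      abs (({p : ℤ × ℤ | 1 ≤ p.2 ∧ Int.gcd p.1 p.2 = 1 ∧
            X ≤ (p.1 : ℝ) / (p.2 : ℝ) ∧ (p.1 : ℝ) / (p.2 : ℝ) ≤ Y ∧
            0 < B * (p.1 : ℝ) * (p.2 : ℝ) + C * (p.2 : ℝ) ^ 2 ∧
            B * (p.1 : ℝ) * (p.2 : ℝ) + C * (p.2 : ℝ) ^ 2 ≤ Δ}.ncard : ℝ) -
          3 * Δ / π ^ 2 * (1 / B) * (Real.log (B * Y + C) - Real.log (B * X + C))) ≤
        c * Δ ^ ((1 : ℝ) / 2 + ε) := by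
  have ha : 0 < B * X + C := by
    rw [div_lt_iff₀ hB] at hX
    linarith
  obtain ⟨K, hK, hKt⟩ := exists_abs_card_sectorPoints_sub_le hB ha hXY
  set a := B * X + C with ha_def
  set A := (log (B * Y + C) - log a) / (2 * B) with hA
  refine ⟨K * (1 + 1 / ((2 * ε) * a ^ ε)) + 2 * |A| * √a, by positivity, 1, fun Δ hΔ => ?_⟩
  have hΔ0 : 0 < Δ := by linarith
  have hset : {p : ℤ × ℤ | 1 ≤ p.2 ∧ Int.gcd p.1 p.2 = 1 ∧
      X ≤ (p.1 : ℝ) / (p.2 : ℝ) ∧ (p.1 : ℝ) / (p.2 : ℝ) ≤ Y ∧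
      0 < B * (p.1 : ℝ) * (p.2 : ℝ) + C * (p.2 : ℝ) ^ 2 ∧
      B * (p.1 : ℝ) * (p.2 : ℝ) + C * (p.2 : ℝ) ^ 2 ≤ Δ} =
      ((sectorPoints B C X Y Δ).filter fun p => Int.gcd p.1 p.2 = 1 : Finset (ℤ × ℤ)) := by
    ext ⟨m, n⟩
    rw [Finset.mem_coe, Finset.mem_filter, mem_sectorPoints hB ha]
    simp only [Set.mem_ofPred_eq]
    constructor
    · rintro ⟨h1, h2, h3, h4, -, h6⟩
      have hn : (0 : ℝ) < n := by exact_mod_cast h1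
      exact ⟨⟨h1, (le_div_iff₀ hn).1 h3, (div_le_iff₀ hn).1 h4, h6⟩, h2⟩
    · rintro ⟨⟨h1, h3, h4, h6⟩, h2⟩
      have hn : (0 : ℝ) < n := by exact_mod_cast h1
      refine ⟨h1, h2, (le_div_iff₀ hn).2 h3, (div_le_iff₀ hn).2 h4, ?_, h6⟩
      have h7 : 0 ≤ B * n * (m - X * n) := by
        have : 0 ≤ (m : ℝ) - X * n := by linarith
        positivity
      have h8 : 0 < a * (n : ℝ) ^ 2 := by positivity
      rw [ha_def] at h8
      nlinarith
  rw [hset, Set.ncard_coe_finset, card_filter_gcd_eq_one_sectorPoints hB ha]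
  set D := ⌊√(Δ / a)⌋₊ with hD
  have hD1 : (D : ℝ) ≤ √(Δ / a) := Nat.floor_le (sqrt_nonneg _)
  have hD2 : √(Δ / a) < D + 1 := Nat.lt_floor_add_one _
  have hmain : |∑ d ∈ Finset.Icc 1 D, (ArithmeticFunction.moebius d : ℝ) *
        (sectorPoints B C X Y (Δ / (d : ℝ) ^ 2)).card -
      A * Δ * ∑ d ∈ Finset.Icc 1 D, (ArithmeticFunction.moebius d : ℝ) / (d : ℝ) ^ 2| ≤
      K * √Δ * harmonic D := by
    rw [Finset.mul_sum, ← Finset.sum_sub_distrib, harmonic_eq_sum_Icc]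
    push_cast
    rw [Finset.mul_sum]
    refine (Finset.abs_sum_le_sum_abs _ _).trans (Finset.sum_le_sum fun d hd => ?_)
    have hd0 : (0 : ℝ) < d := by exact_mod_cast (Finset.mem_Icc.1 hd).1
    have h1 := hKt (Δ / (d : ℝ) ^ 2) (by positivity)
    have hmu : |(ArithmeticFunction.moebius d : ℝ)| ≤ 1 := by
      exact_mod_cast ArithmeticFunction.abs_moebius_le_one
    calc _ = |(ArithmeticFunction.moebius d : ℝ)| *
          |((sectorPoints B C X Y (Δ / (d : ℝ) ^ 2)).card : ℝ) -
          A * (Δ / (d : ℝ) ^ 2)| := by rw [← abs_mul]; congr 1; ring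
      _ ≤ 1 * (K * √(Δ / (d : ℝ) ^ 2)) := by gcongr
      _ = _ := by rw [sqrt_div hΔ0.le, sqrt_sq hd0.le]; ring
  have htail : |A * Δ * ∑ d ∈ Finset.Icc 1 D, (ArithmeticFunction.moebius d : ℝ) / (d : ℝ) ^ 2 -
      A * Δ * (6 / π ^ 2)| ≤ 2 * |A| * √a * √Δ := by
    rw [← mul_sub, abs_mul, abs_mul, abs_of_pos hΔ0]
    have hs : 0 < √(Δ / a) := by positivity
    calc _ ≤ |A| * Δ * (2 / √(Δ / a)) := by
          gcongr
          exact (abs_sum_moebius_div_sq_sub_le D).trans (by gcongr)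
      _ = |A| * (√Δ * √Δ) * (2 / (√Δ / √a)) := by rw [mul_self_sqrt hΔ0.le, sqrt_div hΔ0.le]
      _ = _ := by field_simp
  have hlog : (harmonic D : ℝ) ≤ (1 + 1 / ((2 * ε) * a ^ ε)) * Δ ^ ε := by
    have h1 : (1 : ℝ) ≤ Δ ^ ε := one_le_rpow hΔ hε.le
    have h2 : log D ≤ (D : ℝ) ^ (2 * ε) / (2 * ε) := log_le_rpow_div (by positivity) (by positivity)
    have h3 : (D : ℝ) ^ (2 * ε) ≤ Δ ^ ε / a ^ ε := by
      calc (D : ℝ) ^ (2 * ε) ≤ √(Δ / a) ^ (2 * ε) := by gcongr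
        _ = (Δ / a) ^ ε := by
          rw [sqrt_eq_rpow, ← rpow_mul (by positivity)]; congr 1; ring
        _ = _ := div_rpow hΔ0.le ha.le _
    calc (harmonic D : ℝ) ≤ 1 + log D := harmonic_le_one_add_log D
      _ ≤ Δ ^ ε + (Δ ^ ε / a ^ ε) / (2 * ε) := by
        gcongr
        exact h2.trans (by gcongr)
      _ = _ := by field_simp
  have hsqrt : √Δ * Δ ^ ε = Δ ^ ((1 : ℝ) / 2 + ε) := by
    rw [rpow_add hΔ0, sqrt_eq_rpow]
  have hsqrt_le : √Δ ≤ Δ ^ ((1 : ℝ) / 2 + ε) := by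
    rw [sqrt_eq_rpow]
    exact rpow_le_rpow_of_exponent_le hΔ (by linarith)
  have hconst : 3 * Δ / π ^ 2 * (1 / B) * (log (B * Y + C) - log a) = A * Δ * (6 / π ^ 2) := by
    rw [hA]; field_simp; ring
  rw [hconst]
  calc _ ≤ K * √Δ * harmonic D + 2 * |A| * √a * √Δ :=
        (abs_sub_le _ _ _).trans (add_le_add hmain htail)
    _ ≤ K * √Δ * ((1 + 1 / ((2 * ε) * a ^ ε)) * Δ ^ ε) +
        2 * |A| * √a * Δ ^ ((1 : ℝ) / 2 + ε) := by gcongr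
    _ = _ := by rw [← hsqrt]; ring
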